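/- Let q* be a joint distribution attaining Ω^{(μ,λ)}(P). Along the iteration q^{[t+1]}(x,y) = exp(−ω_{q^{[t]}}^{(μ,λ)}(x,y)) q^{[t]}(x,y) / Λ_{q^{[t]}}^{(μ,λ)} started from a joint distribution q^{[1]} with all components positive, for every t ≥ 1: 0 ≤ −log Λ_{q^{[t]}}^{(μ,λ)} − Ω^{(μ,λ)}(P) ≤ D(q*||q^{[t]}) − D(q*||q^{[t+1]}); in particular the sequence t ↦ D(q*||q^{[t]}) is nonincreasing. -/

import Mathlib

open Real Filter

noncomputable section

def IsDist {X : Type*} [Fintype X] (P : X → ℝ) : Prop :=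
  (∀ x, 0 ≤ P x) ∧ ∑ x, P x = 1

def IsJoint {X Y : Type*} [Fintype X] [Fintype Y] (q : X → Y → ℝ) : Prop :=
  (∀ x y, 0 ≤ q x y) ∧ ∑ x, ∑ y, q x y = 1

def IsCond {X Y : Type*} [Fintype X] [Fintype Y] (V : X → Y → ℝ) : Prop :=
  (∀ x y, 0 ≤ V x y) ∧ ∀ x, ∑ y, V x y = 1

def margX {X Y : Type*} [Fintype Y] (q : X → Y → ℝ) (x : X) : ℝ := ∑ y, q x y

def margY {X Y : Type*} [Fintype X] (q : X → Y → ℝ) (y : Y) : ℝ := ∑ x, q x y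

/-- conditional distribution of `X` given `Y` : `q_{X|Y}(x|y)` -/
def condXY {X Y : Type*} [Fintype X] (q : X → Y → ℝ) (x : X) (y : Y) : ℝ :=
  q x y / margY q y

/-- conditional distribution of `Y` given `X` : `q_{Y|X}(y|x)` -/
def condYX {X Y : Type*} [Fintype Y] (q : X → Y → ℝ) (x : X) (y : Y) : ℝ :=
  q x y / margX q x

/-- mutual information `I(q_X, q_{Y|X})` of a joint distribution `q` -/
def mutInfo {X Y : Type*} [Fintype X] [Fintype Y] (q : X → Y → ℝ) : ℝ :=
  ∑ x, ∑ y, q x y * Real.log (q x y / (margX q x * margY q y))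

/-- divergence `D(q_X ‖ P)` -/
def klX {X Y : Type*} [Fintype X] [Fintype Y] (q : X → Y → ℝ) (P : X → ℝ) : ℝ :=
  ∑ x, margX q x * Real.log (margX q x / P x)

/-- divergence `D(p ‖ q)` of distributions on `X` -/
def klD {X : Type*} [Fintype X] (p q : X → ℝ) : ℝ :=
  ∑ x, p x * Real.log (p x / q x)

/-- divergence `D(q ‖ p)` of joint distributions -/
def klJoint {X Y : Type*} [Fintype X] [Fintype Y] (q p : X → Y → ℝ) : ℝ :=
  ∑ x, ∑ y, q x y * Real.log (q x y / p x y)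

/-- expected distortion `E_q[d(X,Y)]` -/
def Ed {X Y : Type*} [Fintype X] [Fintype Y] (q d : X → Y → ℝ) : ℝ :=
  ∑ x, ∑ y, q x y * d x y

/-- `G(R,Δ|P)` -/
def G {X Y : Type*} [Fintype X] [Fintype Y] (P : X → ℝ) (d : X → Y → ℝ) (R Δ : ℝ) : ℝ :=
  sInf {v : ℝ | ∃ q : X → Y → ℝ, IsJoint q ∧ Ed q d ≤ Δ ∧
    v = max 0 (mutInfo q - R) + klX q P}

/-- `G^{(λ)}(R,Δ|P)` -/
def Glam {X Y : Type*} [Fintype X] [Fintype Y] (P : X → ℝ) (d : X → Y → ℝ)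
    (lam R Δ : ℝ) : ℝ :=
  sInf {v : ℝ | ∃ q : X → Y → ℝ, IsJoint q ∧ Ed q d ≤ Δ ∧
    v = lam * (mutInfo q - R) + klX q P}

/-- rate distortion function `R(Δ|P)` -/
def RD {X Y : Type*} [Fintype X] [Fintype Y] (P : X → ℝ) (d : X → Y → ℝ) (Δ : ℝ) : ℝ :=
  sInf {v : ℝ | ∃ V : X → Y → ℝ, IsCond V ∧ Ed (fun x y => P x * V x y) d ≤ Δ ∧
    v = mutInfo (fun x y => P x * V x y)}

/-- `Ω^{(μ,λ)}(P)` -/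
def OmegaF {X Y : Type*} [Fintype X] [Fintype Y] (P : X → ℝ) (d : X → Y → ℝ)
    (μ lam : ℝ) : ℝ :=
  sInf {v : ℝ | ∃ q : X → Y → ℝ, IsJoint q ∧
    v = lam * mutInfo q + klX q P + μ * Ed q d}

/-- `G^{(μ,λ)}(R,Δ|P) = Ω^{(μ,λ)}(P) − λR − μΔ` -/
def Gmulam {X Y : Type*} [Fintype X] [Fintype Y] (P : X → ℝ) (d : X → Y → ℝ)
    (μ lam R Δ : ℝ) : ℝ :=
  OmegaF P d μ lam - lam * R - μ * Δ

/-- `ω_q^{(μ,λ)}(x,y)` -/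
def omg {X Y : Type*} [Fintype X] [Fintype Y] (P : X → ℝ) (d : X → Y → ℝ)
    (μ lam : ℝ) (q : X → Y → ℝ) (x : X) (y : Y) : ℝ :=
  Real.log (margX q x ^ (1 - lam) * condXY q x y ^ lam * Real.exp (μ * d x y) / P x)

/-- `F^{(μ,λ)}(p,q) = E_q[ω_p^{(μ,λ)}(X,Y)] + D(q‖p)` -/
def Ffun {X Y : Type*} [Fintype X] [Fintype Y] (P : X → ℝ) (d : X → Y → ℝ)
    (μ lam : ℝ) (p q : X → Y → ℝ) : ℝ :=
  (∑ x, ∑ y, q x y * omg P d μ lam p x y) + klJoint q p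

/-- `Λ_p^{(μ,λ)} = E_p[exp(−ω_p^{(μ,λ)}(X,Y))]` -/
def Lam {X Y : Type*} [Fintype X] [Fintype Y] (P : X → ℝ) (d : X → Y → ℝ)
    (μ lam : ℝ) (p : X → Y → ℝ) : ℝ :=
  ∑ x, ∑ y, p x y * Real.exp (-(omg P d μ lam p x y))

/-- cutoff rate `R_cut^{(λ)}(Δ|P)` -/
def Rcut {X Y : Type*} [Fintype X] [Fintype Y] (P : X → ℝ) (d : X → Y → ℝ)
    (lam Δ : ℝ) : ℝ :=
  sInf {v : ℝ | ∃ q : X → Y → ℝ, IsJoint q ∧ Ed q d ≤ Δ ∧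
    v = mutInfo q + (1 / lam) * klX q P}

/-- Shannon entropy -/
def entropy {X : Type*} [Fintype X] (p : X → ℝ) : ℝ :=
  -∑ x, p x * Real.log (p x)

/-- log-sum inequality -/
theorem log_sum_inequality {ι : Type*} [Fintype ι] (a b : ι → ℝ) (ha : ∀ i, 0 ≤ a i)
    (hb : ∀ i, 0 ≤ b i) (hab : ∀ i, b i = 0 → a i = 0) :
    (∑ i, a i) * Real.log ((∑ i, a i) / ∑ i, b i) ≤ ∑ i, a i * Real.log (a i / b i) := by
  rcases (Finset.sum_nonneg fun i _ => ha i).eq_or_lt with hA | hA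
  · have h0 := (Finset.sum_eq_zero_iff_of_nonneg fun i _ => ha i).1 hA.symm
    simp [fun i => h0 i (Finset.mem_univ i)]
  rcases (Finset.sum_nonneg fun i _ => hb i).eq_or_lt with hB | hB
  · have h0 := (Finset.sum_eq_zero_iff_of_nonneg fun i _ => hb i).1 hB.symm
    simp [fun i => hab i (h0 i (Finset.mem_univ i))]
  set A := ∑ i, a i with hAdef
  set B := ∑ i, b i with hBdef
  have key : ∀ i, a i * Real.log (A / B) + (a i - b i * (A / B)) ≤
      a i * Real.log (a i / b i) := by
    intro i
    have hAB : 0 < A / B := div_pos hA hB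
    rcases (ha i).eq_or_lt with h | h
    · rw [← h]
      have := mul_nonneg (hb i) hAB.le
      linarith
    · have hbi : 0 < b i := (hb i).lt_of_ne fun h' => h.ne' (hab i h'.symm)
      have h1 := Real.log_le_sub_one_of_pos (div_pos (mul_pos hbi hAB) h)
      rw [Real.log_div (mul_pos hbi hAB).ne' h.ne', Real.log_mul hbi.ne' hAB.ne'] at h1
      rw [Real.log_div h.ne' hbi.ne']
      have h2 := mul_le_mul_of_nonneg_left h1 h.le
      have h3 : a i * (b i * (A / B) / a i - 1) = b i * (A / B) - a i := by
        field_simp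
      rw [h3] at h2
      linarith
  have hsum := Finset.sum_le_sum fun i (_ : i ∈ Finset.univ) => key i
  rw [Finset.sum_add_distrib, Finset.sum_sub_distrib, ← Finset.sum_mul, ← Finset.sum_mul,
    ← hAdef, ← hBdef, mul_div_cancel₀ _ hB.ne'] at hsum
  linarith

section Joint

variable {X Y : Type*} [Fintype X] [Fintype Y]

theorem IsJoint.swap {q : X → Y → ℝ} (hq : IsJoint q) : IsJoint fun y x => q x y :=
  ⟨fun y x => hq.1 x y, by rw [Finset.sum_comm]; exact hq.2⟩

theorem IsJoint.le_margX {q : X → Y → ℝ} (hq : IsJoint q) (x : X) (y : Y) :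
    q x y ≤ margX q x :=
  Finset.single_le_sum (fun y _ => hq.1 x y) (Finset.mem_univ y)

theorem IsJoint.le_margY {q : X → Y → ℝ} (hq : IsJoint q) (x : X) (y : Y) :
    q x y ≤ margY q y :=
  hq.swap.le_margX y x

theorem IsJoint.isDist_margX {q : X → Y → ℝ} (hq : IsJoint q) : IsDist (margX q) :=
  ⟨fun x => Finset.sum_nonneg fun y _ => hq.1 x y, hq.2⟩

theorem klX_nonneg {q : X → Y → ℝ} {P : X → ℝ} (hq : IsJoint q) (hP : IsDist P)
    (hac : ∀ x, P x = 0 → margX q x = 0) : 0 ≤ klX q P := by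
  have h := log_sum_inequality (margX q) P hq.isDist_margX.1 hP.1 hac
  rwa [hq.isDist_margX.2, hP.2, div_one, Real.log_one, mul_zero] at h

theorem klX_margX_nonneg {q p : X → Y → ℝ} (hq : IsJoint q) (hp : IsJoint p)
    (hpos : ∀ x y, 0 < p x y) : 0 ≤ klX q (margX p) := by
  refine klX_nonneg hq hp.isDist_margX fun x hx => Finset.sum_eq_zero fun y _ => ?_
  exact absurd hx ((hpos x y).trans_le (hp.le_margX x y)).ne'

theorem klX_margX_le_klJoint {q p : X → Y → ℝ} (hq : IsJoint q)
    (hpos : ∀ x y, 0 < p x y) : klX q (margX p) ≤ klJoint q p :=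
  Finset.sum_le_sum fun x _ => log_sum_inequality (q x) (p x) (hq.1 x)
    (fun y => (hpos x y).le) fun y h => absurd h (hpos x y).ne'

theorem klJoint_swap (q p : X → Y → ℝ) :
    klJoint (fun y x => q x y) (fun y x => p x y) = klJoint q p :=
  Finset.sum_comm

theorem mutInfo_nonneg {q : X → Y → ℝ} (hq : IsJoint q) : 0 ≤ mutInfo q := by
  refine Finset.sum_nonneg fun x _ => ?_
  have hX := hq.isDist_margX.1
  have hY : ∀ y, 0 ≤ margY q y := hq.swap.isDist_margX.1
  have h := log_sum_inequality (q x) (fun y => margX q x * margY q y) (hq.1 x)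
    (fun y => mul_nonneg (hX x) (hY y)) fun y h => by
      rcases mul_eq_zero.1 h with h | h
      · exact le_antisymm (h ▸ hq.le_margX x y) (hq.1 x y)
      · exact le_antisymm (h ▸ hq.le_margY x y) (hq.1 x y)
  have hsum : ∑ y, margY q y = 1 := hq.swap.isDist_margX.2
  rw [← Finset.mul_sum, hsum, mul_one] at h
  refine le_trans (le_of_eq ?_) h
  change 0 = margX q x * Real.log (margX q x / margX q x)
  rcases eq_or_ne (margX q x) 0 with h0 | h0
  · simp [h0]
  · simp [div_self h0]

theorem OmegaF_le {P : X → ℝ} {d : X → Y → ℝ} {μ lam : ℝ} (hP : IsDist P)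
    (hPpos : ∀ x, 0 < P x) (hd : ∀ x y, 0 ≤ d x y) (hμ : 0 ≤ μ) (hlam0 : 0 ≤ lam)
    {q : X → Y → ℝ} (hq : IsJoint q) :
    OmegaF P d μ lam ≤ lam * mutInfo q + klX q P + μ * Ed q d := by
  refine csInf_le ⟨0, ?_⟩ ⟨q, hq, rfl⟩
  rintro _ ⟨r, hr, rfl⟩
  have hE : 0 ≤ Ed r d := Finset.sum_nonneg fun x _ => Finset.sum_nonneg fun y _ =>
    mul_nonneg (hr.1 x y) (hd x y)
  have hI := mutInfo_nonneg hr
  have hK := klX_nonneg hr hP fun x hx => absurd hx (hPpos x).ne'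
  positivity

theorem objective_eq {P : X → ℝ} {d : X → Y → ℝ} {μ lam : ℝ} (hPpos : ∀ x, 0 < P x)
    {q p : X → Y → ℝ} (hq : IsJoint q) (hp : IsJoint p) (hpos : ∀ x y, 0 < p x y) :
    lam * mutInfo q + klX q P + μ * Ed q d =
      (∑ x, ∑ y, q x y * omg P d μ lam p x y) + (1 - lam) * klX q (margX p) +
        lam * (klJoint q p - klX (fun y x => q x y) (margY p)) := by
  have hX : ∀ R : X → ℝ, klX q R = ∑ x, ∑ y, q x y * Real.log (margX q x / R x) :=
    fun R => Finset.sum_congr rfl fun x _ => Finset.sum_mul _ _ _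
  have hY : klX (fun y x => q x y) (margY p) =
      ∑ x, ∑ y, q x y * Real.log (margY q y / margY p y) := by
    rw [Finset.sum_comm]
    exact Finset.sum_congr rfl fun y _ => Finset.sum_mul _ _ _
  rw [hX, hX, hY]
  simp only [mutInfo, Ed, klJoint, Finset.mul_sum, ← Finset.sum_add_distrib,
    ← Finset.sum_sub_distrib]
  refine Finset.sum_congr rfl fun x _ => Finset.sum_congr rfl fun y _ => ?_
  rcases (hq.1 x y).eq_or_lt with h | h
  · simp [← h]
  have hqX := h.trans_le (hq.le_margX x y)
  have hqY := h.trans_le (hq.le_margY x y)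
  have hp0 := hpos x y
  have hpX := hp0.trans_le (hp.le_margX x y)
  have hpY := hp0.trans_le (hp.le_margY x y)
  have hc : 0 < condXY p x y := div_pos hp0 hpY
  have hom : omg P d μ lam p x y = (1 - lam) * Real.log (margX p x) +
      lam * (Real.log (p x y) - Real.log (margY p y)) + μ * d x y - Real.log (P x) := by
    rw [omg, Real.log_div (by positivity) (hPpos x).ne', Real.log_mul (by positivity)
      (by positivity), Real.log_mul (by positivity) (by positivity), Real.log_rpow hpX,
      Real.log_rpow hc, Real.log_exp, condXY, Real.log_div hp0.ne' hpY.ne']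
  rw [hom, Real.log_div h.ne' (by positivity), Real.log_mul hqX.ne' hqY.ne',
    Real.log_div hqX.ne' (hPpos x).ne', Real.log_div hqX.ne' hpX.ne',
    Real.log_div h.ne' hp0.ne', Real.log_div hqY.ne' hpY.ne']
  ring

theorem Lam_pos {P : X → ℝ} {d : X → Y → ℝ} {μ lam : ℝ} {p : X → Y → ℝ} (hp : IsJoint p)
    (hpos : ∀ x y, 0 < p x y) : 0 < Lam P d μ lam p := by
  have hX : Nonempty X := by
    by_contra h
    rw [not_nonempty_iff] at h
    simpa using hp.2
  have hY : Nonempty Y := by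
    by_contra h
    rw [not_nonempty_iff] at h
    simpa using hp.2
  exact Finset.sum_pos (fun x _ => Finset.sum_pos
    (fun y _ => mul_pos (hpos x y) (Real.exp_pos _)) Finset.univ_nonempty) Finset.univ_nonempty

/-- One step of the iteration. -/
def tilt (P : X → ℝ) (d : X → Y → ℝ) (μ lam : ℝ) (p : X → Y → ℝ) (x : X) (y : Y) : ℝ :=
  Real.exp (-(omg P d μ lam p x y)) * p x y / Lam P d μ lam p

theorem tilt_pos {P : X → ℝ} {d : X → Y → ℝ} {μ lam : ℝ} {p : X → Y → ℝ} (hp : IsJoint p)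
    (hpos : ∀ x y, 0 < p x y) (x : X) (y : Y) : 0 < tilt P d μ lam p x y :=
  div_pos (mul_pos (Real.exp_pos _) (hpos x y)) (Lam_pos hp hpos)

theorem isJoint_tilt {P : X → ℝ} {d : X → Y → ℝ} {μ lam : ℝ} {p : X → Y → ℝ}
    (hp : IsJoint p) (hpos : ∀ x y, 0 < p x y) : IsJoint (tilt P d μ lam p) := by
  refine ⟨fun x y => (tilt_pos hp hpos x y).le, ?_⟩
  simp only [tilt, ← Finset.sum_div]
  rw [div_eq_one_iff_eq (Lam_pos hp hpos).ne']
  simp only [Lam, mul_comm]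

theorem Ffun_eq_klJoint_tilt {P : X → ℝ} {d : X → Y → ℝ} {μ lam : ℝ} {p q : X → Y → ℝ}
    (hq : IsJoint q) (hp : IsJoint p) (hpos : ∀ x y, 0 < p x y) :
    Ffun P d μ lam p q = klJoint q (tilt P d μ lam p) - Real.log (Lam P d μ lam p) := by
  have hL := Lam_pos (P := P) (d := d) (μ := μ) (lam := lam) hp hpos
  have h1 : Real.log (Lam P d μ lam p) = ∑ x, ∑ y, q x y * Real.log (Lam P d μ lam p) := by
    simp only [← Finset.sum_mul]
    rw [hq.2, one_mul]
  rw [h1]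
  simp only [Ffun, klJoint, ← Finset.sum_add_distrib, ← Finset.sum_sub_distrib]
  refine Finset.sum_congr rfl fun x _ => Finset.sum_congr rfl fun y _ => ?_
  rcases (hq.1 x y).eq_or_lt with h | h
  · simp [← h]
  have hp0 := hpos x y
  rw [Real.log_div h.ne' (tilt_pos hp hpos x y).ne', tilt,
    Real.log_div (by positivity) hL.ne', Real.log_mul (by positivity) hp0.ne', Real.log_exp,
    Real.log_div h.ne' hp0.ne']
  ring

theorem klJoint_self {p : X → Y → ℝ} (hpos : ∀ x y, 0 < p x y) : klJoint p p = 0 :=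
  Finset.sum_eq_zero fun x _ => Finset.sum_eq_zero fun y _ => by
    rw [div_self (hpos x y).ne', Real.log_one, mul_zero]

theorem objective_le_Ffun {P : X → ℝ} {d : X → Y → ℝ} {μ lam : ℝ} (hPpos : ∀ x, 0 < P x)
    (hlam0 : 0 ≤ lam) (hlam1 : lam ≤ 1) {q p : X → Y → ℝ} (hq : IsJoint q)
    (hp : IsJoint p) (hpos : ∀ x y, 0 < p x y) :
    lam * mutInfo q + klX q P + μ * Ed q d ≤ Ffun P d μ lam p q := by
  rw [objective_eq hPpos hq hp hpos, Ffun]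
  have hY : 0 ≤ klX (fun y x => q x y) (margY p) :=
    klX_margX_nonneg hq.swap hp.swap fun y x => hpos x y
  have h1 := mul_le_mul_of_nonneg_left (klX_margX_le_klJoint hq hpos) (sub_nonneg.2 hlam1)
  have h2 := mul_nonneg hlam0 hY
  linarith

theorem sum_mul_omg_le_objective {P : X → ℝ} {d : X → Y → ℝ} {μ lam : ℝ}
    (hPpos : ∀ x, 0 < P x) (hlam0 : 0 ≤ lam) (hlam1 : lam ≤ 1) {q p : X → Y → ℝ}
    (hq : IsJoint q) (hp : IsJoint p) (hpos : ∀ x y, 0 < p x y) :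
    ∑ x, ∑ y, q x y * omg P d μ lam p x y ≤ lam * mutInfo q + klX q P + μ * Ed q d := by
  rw [objective_eq hPpos hq hp hpos]
  have hY : klX (fun y x => q x y) (margY p) ≤ klJoint q p :=
    (klX_margX_le_klJoint hq.swap fun y x => hpos x y).trans_eq (klJoint_swap q p)
  have h1 := mul_nonneg (sub_nonneg.2 hlam1) (klX_margX_nonneg hq hp hpos)
  have h2 := mul_nonneg hlam0 (sub_nonneg.2 hY)
  linarith

end Joint

/-- with `q*` attaining `Ω^{(μ,λ)}(P)`, along the iteration,
`0 ≤ −log Λ_{q^{[t]}} − Ω^{(μ,λ)}(P) ≤ D(q*‖q^{[t]}) − D(q*‖q^{[t+1]})`;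
in particular `t ↦ D(q*‖q^{[t]})` is nonincreasing. -/
theorem stmt13 {X Y : Type*} [Fintype X] [Fintype Y]
    (P : X → ℝ) (hP : IsDist P) (hPpos : ∀ x, 0 < P x)
    (d : X → Y → ℝ) (hd : ∀ x y, 0 ≤ d x y)
    (μ lam : ℝ) (hμ : 0 ≤ μ) (hlam0 : 0 ≤ lam) (hlam1 : lam ≤ 1)
    (qstar : X → Y → ℝ) (hqstar : IsJoint qstar)
    (hqstaropt : lam * mutInfo qstar + klX qstar P + μ * Ed qstar d =
      OmegaF P d μ lam)
    (qseq : ℕ → X → Y → ℝ)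
    (hinit : IsJoint (qseq 1)) (hinitpos : ∀ x y, 0 < qseq 1 x y)
    (hstep : ∀ t : ℕ, 1 ≤ t → ∀ x y,
      qseq (t + 1) x y =
        Real.exp (-(omg P d μ lam (qseq t) x y)) * qseq t x y /
          Lam P d μ lam (qseq t)) :
    ∀ t : ℕ, 1 ≤ t →
      0 ≤ -Real.log (Lam P d μ lam (qseq t)) - OmegaF P d μ lam ∧
      -Real.log (Lam P d μ lam (qseq t)) - OmegaF P d μ lam ≤
        klJoint qstar (qseq t) - klJoint qstar (qseq (t + 1)) ∧
      klJoint qstar (qseq (t + 1)) ≤ klJoint qstar (qseq t) := by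
  have hstep' : ∀ t : ℕ, 1 ≤ t → qseq (t + 1) = tilt P d μ lam (qseq t) :=
    fun t ht => funext fun x => funext fun y => hstep t ht x y
  have hseq : ∀ t : ℕ, 1 ≤ t → IsJoint (qseq t) ∧ ∀ x y, 0 < qseq t x y := by
    intro t ht
    induction t, ht using Nat.le_induction with
    | base => exact ⟨hinit, hinitpos⟩
    | succ t ht ih =>
      rw [hstep' t ht]
      exact ⟨isJoint_tilt ih.1 ih.2, tilt_pos ih.1 ih.2⟩
  intro t ht
  obtain ⟨hp, hpos⟩ := hseq t ht
  rw [hstep' t ht]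
  have hp' : IsJoint (tilt P d μ lam (qseq t)) := isJoint_tilt hp hpos
  have hΩ := OmegaF_le hP hPpos hd hμ hlam0 hp'
  have hF' := objective_le_Ffun (d := d) (μ := μ) hPpos hlam0 hlam1 hp' hp hpos
  rw [Ffun_eq_klJoint_tilt hp' hp hpos, klJoint_self (tilt_pos hp hpos)] at hF'
  have hω := sum_mul_omg_le_objective (d := d) (μ := μ) hPpos hlam0 hlam1 hqstar hp hpos
  have hF := Ffun_eq_klJoint_tilt (P := P) (d := d) (μ := μ) (lam := lam) hqstar hp hpos
  rw [Ffun] at hF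
  exact ⟨by linarith, by linarith, by linarith⟩
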